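/- arXiv:math/0703001 — 6 statements merged into one kernel-verified Lean document; each statement's English description precedes it below -/
import Mathlib

section
/- Let G be a complex Hilbert space, let C be a commutative von Neumann subalgebra of B(G), and let h ∈ B(G) be such that for every c ∈ C the commutator [c,h] = ch − hc lies in the commutant C' of C. Then [c,h] = 0 for all c ∈ C. -/
/-- If `u` commutes with `[u, h]`, then `[u ^ (n + 1), h] = (n + 1) • (u ^ n * [u, h])`. -/
theorem pow_succ_mul_sub_mul_pow_succ_of_commute {R : Type*} [Ring R] {u h : R}
    (hu : Commute u (u * h - h * u)) (n : ℕ) :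
    u ^ (n + 1) * h - h * u ^ (n + 1) = (n + 1 : ℕ) • (u ^ n * (u * h - h * u)) := by
  induction n with
  | zero => simp
  | succ n ih =>
    have key : u ^ (n + 2) * h - h * u ^ (n + 2) =
        u * (u ^ (n + 1) * h - h * u ^ (n + 1)) + (u * h - h * u) * u ^ (n + 1) := by
      rw [pow_succ' u (n + 1)]
      noncomm_ring
    rw [key, ih, ← (hu.pow_left (n + 1)).eq, mul_smul_comm, ← mul_assoc, ← pow_succ',
      succ_nsmul _ (n + 1)]

/-- A unitary element that commutes with its commutator with `h` commutes with `h`: the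
commutators of `h` with the powers of `u` are bounded, but their norms grow linearly. -/
theorem commutator_eq_zero_of_mem_unitary_of_commute {A : Type*} [CStarAlgebra A] {u h : A}
    (hu : u ∈ unitary A) (hc : Commute u (u * h - h * u)) : u * h - h * u = 0 := by
  have bound (n : ℕ) : n * ‖u * h - h * u‖ ≤ 2 * ‖h‖ := by
    cases n with
    | zero => simp
    | succ n =>
      calc ((n + 1 : ℕ) : ℝ) * ‖u * h - h * u‖
          = ‖(n + 1 : ℕ) • (u ^ n * (u * h - h * u))‖ := by
            rw [← Nat.cast_smul_eq_nsmul ℝ, norm_smul,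
              CStarRing.norm_mem_unitary_mul _ (pow_mem hu n), Real.norm_natCast]
        _ = ‖u ^ (n + 1) * h - h * u ^ (n + 1)‖ := by
            rw [pow_succ_mul_sub_mul_pow_succ_of_commute hc]
        _ ≤ ‖u ^ (n + 1) * h‖ + ‖h * u ^ (n + 1)‖ := norm_sub_le _ _
        _ = 2 * ‖h‖ := by
            rw [CStarRing.norm_mem_unitary_mul _ (pow_mem hu _),
              CStarRing.norm_mul_mem_unitary _ (pow_mem hu _), two_mul]
  by_contra hne
  obtain ⟨n, hn⟩ := exists_nat_gt (2 * ‖h‖ / ‖u * h - h * u‖)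
  rw [div_lt_iff₀ (norm_pos_iff.mpr hne)] at hn
  exact (bound n).not_gt hn

/-- A von Neumann algebra is norm closed. -/
theorem VonNeumannAlgebra.isClosed {G : Type*} [NormedAddCommGroup G] [InnerProductSpace ℂ G]
    [CompleteSpace G] (C : VonNeumannAlgebra G) : IsClosed (C : Set (G →L[ℂ] G)) := by
  rw [← C.centralizer_centralizer]
  exact Set.isClosed_centralizer _

/-- If `C` is a commutative von Neumann subalgebra of `B(G)` and `h ∈ B(G)` is such that
for every `c ∈ C` the commutator `[c, h] = c * h - h * c` lies in the commutant `C'` of `C`,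
then `[c, h] = 0` for all `c ∈ C`. -/
theorem commutator_eq_zero_of_commutator_mem_commutant
    {G : Type*} [NormedAddCommGroup G] [InnerProductSpace ℂ G] [CompleteSpace G]
    (C : VonNeumannAlgebra G)
    (hComm : ∀ c₁ ∈ C, ∀ c₂ ∈ C, c₁ * c₂ = c₂ * c₁)
    (h : G →L[ℂ] G)
    (hc : ∀ c ∈ C, c * h - h * c ∈ C.commutant) :
    ∀ c ∈ C, c * h - h * c = 0 := by
  intro c hcC
  have hclosed : IsClosed (C.toStarSubalgebra : Set (G →L[ℂ] G)) := C.isClosed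
  let _ : CStarAlgebra C.toStarSubalgebra :=
    StarSubalgebra.cstarAlgebra C.toStarSubalgebra (h_closed := hclosed)
  have hspan : (⟨c, hcC⟩ : C.toStarSubalgebra) ∈
      Submodule.span ℂ (unitary C.toStarSubalgebra : Set C.toStarSubalgebra) := by
    rw [CStarAlgebra.span_unitary]
    trivial
  suffices ∀ x ∈ Submodule.span ℂ (unitary C.toStarSubalgebra : Set C.toStarSubalgebra),
      Commute (x : G →L[ℂ] G) h from sub_eq_zero.mpr (this _ hspan).eq
  intro x hx
  induction hx using Submodule.span_induction with
  | mem u hu =>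
    have hu' : (u : G →L[ℂ] G) ∈ unitary (G →L[ℂ] G) :=
      Unitary.map_mem C.toStarSubalgebra.subtype hu
    exact sub_eq_zero.mp <| commutator_eq_zero_of_mem_unitary_of_commute hu' <|
      VonNeumannAlgebra.mem_commutant_iff.mp (hc u u.2) u u.2
  | zero => exact Commute.zero_left h
  | add x y _ _ hx hy => exact hx.add_left hy
  | smul r x _ hx => exact hx.smul_left r
end

section
/- Let B be a von Neumann algebra on a complex Hilbert space G, let C be a maximal commutative subalgebra of B, and let h ∈ B be such that for every c ∈ C the commutator [c,h] = ch − hc commutes with every element of C. Then h ∈ C. -/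
/-- If the commutator of `u` and `h` commutes with `u`, then `[u ^ n, h]` is the Leibniz
expression `n u ^ (n - 1) [u, h]`. -/
theorem pow_succ_mul_sub_mul_pow_succ {R : Type*} [Ring R] {u h : R}
    (hu : Commute (u * h - h * u) u) (n : ℕ) :
    u ^ (n + 1) * h - h * u ^ (n + 1) = ((n + 1 : ℕ) : R) * (u ^ n * (u * h - h * u)) := by
  induction n with
  | zero => simp
  | succ n ih =>
    have key : u ^ (n + 1 + 1) * h - h * u ^ (n + 1 + 1)
        = u ^ (n + 1) * (u * h - h * u) + (u ^ (n + 1) * h - h * u ^ (n + 1)) * u := by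
      simp only [pow_succ]
      noncomm_ring
    rw [key, ih, mul_assoc, mul_assoc, hu.eq, ← mul_assoc (u ^ n), ← pow_succ]
    push_cast
    noncomm_ring

/-- A unitary that commutes with its commutator with `h` commutes with `h`. -/
theorem commute_of_mem_unitary_of_commute_commutator {A : Type*} [CStarAlgebra A] {u h : A}
    (hu : u ∈ unitary A) (hc : Commute (u * h - h * u) u) : Commute u h := by
  have bound (n : ℕ) : n • ‖u * h - h * u‖ ≤ 2 * ‖h‖ := by
    cases n with
    | zero => simp
    | succ n =>
      have hpow (k : ℕ) : u ^ k ∈ unitary A := pow_mem hu k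
      calc (n + 1) • ‖u * h - h * u‖
          = ‖((n + 1 : ℕ) : A) * (u ^ n * (u * h - h * u))‖ := by
            rw [← nsmul_eq_mul, RCLike.norm_nsmul ℂ, CStarRing.norm_mem_unitary_mul _ (hpow n)]
        _ = ‖u ^ (n + 1) * h - h * u ^ (n + 1)‖ := by
            rw [pow_succ_mul_sub_mul_pow_succ hc]
        _ ≤ ‖u ^ (n + 1) * h‖ + ‖h * u ^ (n + 1)‖ := norm_sub_le _ _
        _ = 2 * ‖h‖ := by
            rw [CStarRing.norm_mem_unitary_mul _ (hpow _),
              CStarRing.norm_mul_mem_unitary _ (hpow _), two_mul]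
  have hzero : ‖u * h - h * u‖ = 0 := by
    by_contra hne
    obtain ⟨n, hn⟩ := exists_lt_nsmul ((norm_nonneg _).lt_of_ne' hne) (2 * ‖h‖)
    exact (bound n).not_gt hn
  exact sub_eq_zero.mp (norm_eq_zero.mp hzero)

/-- An element whose commutators with a closed commutative star subalgebra `C` commute with `C`
commutes with `C`. -/
theorem StarSubalgebra.commute_of_commute_commutator {A : Type*} [CStarAlgebra A]
    {C : StarSubalgebra ℂ A} (hC : IsClosed (C : Set A)) {h : A}
    (hc : ∀ c ∈ C, Commute (c * h - h * c) c) {c : A} (hcC : c ∈ C) : Commute c h := by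
  have : IsClosed (C : Set A) := hC
  obtain ⟨u, a, hx, -⟩ := CStarAlgebra.exists_sum_four_unitary (⟨c, hcC⟩ : C)
  have hx' : c = ∑ i, a i • ((u i : C) : A) := by
    simpa using congrArg C.subtype hx
  rw [hx']
  refine Commute.sum_left _ _ _ fun i _ ↦ Commute.smul_left ?_ _
  exact commute_of_mem_unitary_of_commute_commutator (Unitary.map_mem C.subtype (u i).2)
    (hc _ (u i : C).2)

/-- If `C` is maximal among the commutative star subalgebras of `B`, then `C` contains every
element of `B` that commutes with all of `C`. -/
theorem StarSubalgebra.mem_of_commute_of_maximal {A : Type*} [Ring A] [StarRing A] [Algebra ℂ A]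
    [StarModule ℂ A] {B C : StarSubalgebra ℂ A} (hCB : C ≤ B)
    (hComm : ∀ c₁ ∈ C, ∀ c₂ ∈ C, c₁ * c₂ = c₂ * c₁)
    (hMax : ∀ D : StarSubalgebra ℂ A,
      (∀ d₁ ∈ D, ∀ d₂ ∈ D, d₁ * d₂ = d₂ * d₁) → C ≤ D → D ≤ B → D = C)
    {x : A} (hxB : x ∈ B) (hx : ∀ c ∈ C, Commute c x) : x ∈ C := by
  have mem_of_isSelfAdjoint {y : A} (hy : IsSelfAdjoint y) (hyB : y ∈ B)
      (hyC : ∀ c ∈ C, Commute c y) : y ∈ C := by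
    have hcomm : ∀ a ∈ insert y (C : Set A), ∀ b ∈ insert y (C : Set A), a * b = b * a := by
      rintro a (rfl | ha) b (rfl | hb)
      · rfl
      · exact (hyC b hb).symm.eq
      · exact (hyC a ha).eq
      · exact hComm a ha b hb
    have hstar : ∀ b ∈ insert y (C : Set A), star b ∈ insert y (C : Set A) := by
      rintro b (rfl | hb)
      · exact Or.inl hy
      · exact Or.inr (star_mem hb)
    have := StarAlgebra.isMulCommutative_adjoin ℂ hcomm
      fun a ha b hb ↦ hcomm a ha _ (hstar b hb)
    have hD : StarAlgebra.adjoin ℂ (insert y (C : Set A)) = C := by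
      refine hMax _ (fun a ha b hb ↦ ?_) (fun c hc ↦ ?_) (StarAlgebra.adjoin_le ?_)
      · exact congrArg Subtype.val (mul_comm' (⟨a, ha⟩ : StarAlgebra.adjoin ℂ _) ⟨b, hb⟩)
      · exact StarAlgebra.subset_adjoin ℂ _ (Or.inr hc)
      · exact Set.insert_subset hyB hCB
    exact hD ▸ StarAlgebra.subset_adjoin ℂ _ (Set.mem_insert y _)
  have hx_star (c : A) (hc : c ∈ C) : Commute c (star x) := by
    simpa using (hx (star c) (star_mem hc)).star_star
  rw [← realPart_add_I_smul_imaginaryPart x]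
  refine add_mem (mem_of_isSelfAdjoint (realPart x).2 ?_ fun c hc ↦ ?_)
    (SMulMemClass.smul_mem _ (mem_of_isSelfAdjoint (imaginaryPart x).2 ?_ fun c hc ↦ ?_))
  · rw [realPart_apply_coe, ← Complex.coe_smul]
    exact SMulMemClass.smul_mem _ (add_mem hxB (star_mem hxB))
  · rw [realPart_apply_coe, ← Complex.coe_smul]
    exact ((hx c hc).add_right (hx_star c hc)).smul_right _
  · rw [imaginaryPart_apply_coe, ← Complex.coe_smul]
    exact SMulMemClass.smul_mem _ (SMulMemClass.smul_mem _ (sub_mem hxB (star_mem hxB)))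
  · rw [imaginaryPart_apply_coe, ← Complex.coe_smul]
    exact (((hx c hc).sub_right (hx_star c hc)).smul_right _).smul_right _

/-- If `C` is a maximal commutative subalgebra of a von Neumann algebra `B` on `G` and
`h ∈ B` is such that for every `c ∈ C` the commutator `[c, h]` commutes with every element
of `C`, then `h ∈ C`. -/
theorem mem_of_commutators_commute_with_maximal_commutative
    {G : Type*} [NormedAddCommGroup G] [InnerProductSpace ℂ G] [CompleteSpace G]
    (B : VonNeumannAlgebra G) (C : StarSubalgebra ℂ (G →L[ℂ] G))
    (hCB : ∀ c ∈ C, c ∈ B)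
    (hComm : ∀ c₁ ∈ C, ∀ c₂ ∈ C, c₁ * c₂ = c₂ * c₁)
    (hMax : ∀ D : StarSubalgebra ℂ (G →L[ℂ] G),
        (∀ d₁ ∈ D, ∀ d₂ ∈ D, d₁ * d₂ = d₂ * d₁) → C ≤ D → (∀ d ∈ D, d ∈ B) → D = C)
    (h : G →L[ℂ] G) (hB : h ∈ B)
    (hc : ∀ c ∈ C, ∀ c' ∈ C, (c * h - h * c) * c' = c' * (c * h - h * c)) :
    h ∈ C := by
  have mem_of_commute {x : G →L[ℂ] G} (hxB : x ∈ B) (hx : ∀ c ∈ C, Commute c x) : x ∈ C :=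
    StarSubalgebra.mem_of_commute_of_maximal (B := B.toStarSubalgebra) hCB hComm hMax hxB hx
  have hclosed : IsClosed (C : Set (G →L[ℂ] G)) := by
    have hC : (C : Set (G →L[ℂ] G)) =
        Set.centralizer (Set.centralizer (B : Set (G →L[ℂ] G))) ∩
          Set.centralizer (C : Set (G →L[ℂ] G)) := by
      rw [B.centralizer_centralizer]
      exact Set.Subset.antisymm (fun c hcC ↦ ⟨hCB c hcC, fun c' hc' ↦ hComm c' hc' c hcC⟩)
        fun x hx ↦ mem_of_commute hx.1 hx.2
    rw [hC]
    exact (Set.isClosed_centralizer _).inter (Set.isClosed_centralizer _)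
  exact mem_of_commute hB fun c hcC ↦
    C.commute_of_commute_commutator hclosed (fun c hcC ↦ hc c hcC c hcC) hcC
end

section
/- Let G be a complex Hilbert space, let C be a commutative *-subalgebra of B(G), let I be a finite index set, and let (L_i)_{i∈I} be a family in B(G). Suppose for every c ∈ C there are elements c_{ij}(c) ∈ C (i, j ∈ I) satisfying c_{ij}(c*) = c_{ji}(c)* and c L_i − L_i c = Σ_{j∈I} c_{ij}(c) L_j for all i ∈ I. Then for all c₁, c₂ ∈ C the operator T(c₁) := Σ_{i∈I} L_i* c₁ L_i commutes with c₂, i.e. [T(c₁), c₂] = 0. -/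
/-- Let `C` be a commutative *-subalgebra of `B(G)` and `(L i)` a finite family of operators.
If for every `c ∈ C` there are coefficients `cc c i j ∈ C` satisfying
`cc (star c) i j = star (cc c j i)` and `c * L i - L i * c = ∑ j, cc c i j * L j`,
then `T(c₁) := ∑ i, star (L i) * c₁ * L i` commutes with every `c₂ ∈ C`. -/
theorem kraus_map_commutes_of_coefficients
    {G : Type*} [NormedAddCommGroup G] [InnerProductSpace ℂ G] [CompleteSpace G]
    (C : StarSubalgebra ℂ (G →L[ℂ] G))
    (hComm : ∀ c₁ ∈ C, ∀ c₂ ∈ C, c₁ * c₂ = c₂ * c₁)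
    {I : Type*} [Fintype I] (L : I → (G →L[ℂ] G))
    (cc : (G →L[ℂ] G) → I → I → (G →L[ℂ] G))
    (hmem : ∀ c ∈ C, ∀ i j, cc c i j ∈ C)
    (hstar : ∀ c ∈ C, ∀ i j, cc (star c) i j = star (cc c j i))
    (hrel : ∀ c ∈ C, ∀ i, c * L i - L i * c = ∑ j, cc c i j * L j) :
    ∀ c₁ ∈ C, ∀ c₂ ∈ C,
      (∑ i, star (L i) * c₁ * L i) * c₂ - c₂ * (∑ i, star (L i) * c₁ * L i) = 0 := by
  intro c₁ h₁ c h
  have hright (i : I) : L i * c = c * L i - ∑ j, cc c i j * L j := by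
    rw [← hrel c h i, sub_sub_cancel]
  have hleft (i : I) : c * star (L i) = star (L i) * c - ∑ j, star (L j) * cc c j i := by
    have hi := congrArg star (hrel (star c) (star_mem h) i)
    simp only [star_sub, star_mul, star_star, star_sum, hstar c h] at hi
    rw [← hi, sub_sub_cancel]
  have hTc : (∑ i, star (L i) * c₁ * L i) * c
      = ∑ i, star (L i) * (c₁ * c) * L i - ∑ i, ∑ j, star (L i) * (c₁ * cc c i j) * L j := by
    rw [Finset.sum_mul, ← Finset.sum_sub_distrib]
    refine Finset.sum_congr rfl fun i _ => ?_
    rw [mul_assoc, hright i, mul_sub, Finset.mul_sum]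
    simp only [mul_assoc]
  have hcT : c * (∑ i, star (L i) * c₁ * L i)
      = ∑ i, star (L i) * (c * c₁) * L i - ∑ i, ∑ j, star (L j) * (cc c j i * c₁) * L i := by
    rw [Finset.mul_sum, ← Finset.sum_sub_distrib]
    refine Finset.sum_congr rfl fun i _ => ?_
    rw [mul_assoc, ← mul_assoc c, hleft i, sub_mul, Finset.sum_mul]
    simp only [mul_assoc]
  rw [hTc, hcT, Finset.sum_comm, hComm c₁ h₁ c h, sub_eq_zero]
  congr 1
  refine Finset.sum_congr rfl fun i _ => Finset.sum_congr rfl fun j _ => ?_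
  rw [hComm c₁ h₁ _ (hmem c h j i)]
end

section
/- Let G be a complex Hilbert space, let C be a maximal abelian von Neumann subalgebra of B(G) (i.e. C equals its own commutant), let I be a finite index set, let (L_i)_{i∈I} be a family in B(G), and define T(b) = Σ_{i∈I} L_i* b L_i. Suppose for every c ∈ C there exist elements c_{ij}(c) ∈ C (i, j ∈ I) satisfying c_{ij}(c*) = c_{ji}(c)* and c L_i − L_i c = Σ_{j∈I} c_{ij}(c) L_j for all i ∈ I. Then T(c) ∈ C for every c ∈ C, i.e. T leaves C globally invariant. -/
/-- (Sufficiency in Corollary 3.4.) Let `C` be a maximal abelian von Neumann subalgebra of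
`B(G)` (i.e. `C` equals its own commutant) and `T(b) = ∑ i, star (L i) * b * L i` a Kraus-form
CP map. If for every `c ∈ C` there are coefficients `cc c i j ∈ C` with
`cc (star c) i j = star (cc c j i)` and `c * L i - L i * c = ∑ j, cc c i j * L j`,
then `T` leaves `C` globally invariant. -/
theorem kraus_map_leaves_masa_invariant_of_coefficients
    {G : Type*} [NormedAddCommGroup G] [InnerProductSpace ℂ G] [CompleteSpace G]
    (C : VonNeumannAlgebra G) (hmasa : C.commutant = C)
    {I : Type*} [Fintype I] (L : I → (G →L[ℂ] G))
    (cc : (G →L[ℂ] G) → I → I → (G →L[ℂ] G))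
    (hmem : ∀ c ∈ C, ∀ i j, cc c i j ∈ C)
    (hstar : ∀ c ∈ C, ∀ i j, cc (star c) i j = star (cc c j i))
    (hrel : ∀ c ∈ C, ∀ i, c * L i - L i * c = ∑ j, cc c i j * L j) :
    ∀ c ∈ C, (∑ i, star (L i) * c * L i) ∈ C := by
  intro b hb
  have hcomm : ∀ x ∈ C, ∀ y ∈ C, x * y = y * x := fun x hx y hy =>
    VonNeumannAlgebra.mem_commutant_iff.1 (hmasa.symm ▸ hy) x hx
  rw [← hmasa, VonNeumannAlgebra.mem_commutant_iff]
  intro a ha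
  have hright : ∀ i, L i * a = a * L i - ∑ j, cc a i j * L j := fun i => by
    rw [← hrel a ha i, sub_sub_cancel]
  have hleft : ∀ i, a * star (L i) = star (L i) * a - ∑ j, star (L j) * cc a j i := fun i => by
    have h := congrArg star (hrel (star a) (star_mem ha) i)
    simp only [star_sub, star_mul, star_star, star_sum, hstar a ha] at h
    rw [← h, sub_sub_cancel]
  have hl : a * ∑ i, star (L i) * b * L i =
      ∑ i, star (L i) * (a * b) * L i - ∑ i, ∑ j, star (L j) * (cc a j i * b) * L i := by
    simp only [Finset.mul_sum, ← Finset.sum_sub_distrib]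
    refine Finset.sum_congr rfl fun i _ => ?_
    rw [← mul_assoc, ← mul_assoc, hleft]
    simp only [sub_mul, Finset.sum_mul, mul_assoc]
  have hr : (∑ i, star (L i) * b * L i) * a =
      ∑ i, star (L i) * (b * a) * L i - ∑ i, ∑ j, star (L i) * (b * cc a i j) * L j := by
    simp only [Finset.sum_mul, ← Finset.sum_sub_distrib]
    refine Finset.sum_congr rfl fun i _ => ?_
    rw [mul_assoc, hright]
    simp only [mul_sub, Finset.mul_sum, mul_assoc]
  rw [hl, hr, Finset.sum_comm, hcomm a ha b hb]
  simp only [fun i j => hcomm _ (hmem a ha i j) b hb]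
end

section
/- Let G be a complex Hilbert space, let C be a maximal abelian von Neumann subalgebra of B(G) (i.e. C equals its own commutant), let I be a finite index set, let (L_i)_{i∈I} be a family in B(G), and define T(b) = Σ_{i∈I} L_i* b L_i. If T(c) ∈ C for every c ∈ C, then there exist functions c_{ij} : C → C (i, j ∈ I) such that for all c ∈ C and all i, j ∈ I one has c_{ij}(c*) = c_{ji}(c)* and c L_i − L_i c = Σ_{j∈I} c_{ij}(c) L_j. -/
namespace KrausMasa

section Intertwiner

variable {A G H : Type*} [Ring A] [StarRing A] [Algebra ℂ A]
  [NormedAddCommGroup G] [InnerProductSpace ℂ G] [CompleteSpace G]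
  [NormedAddCommGroup H] [InnerProductSpace ℂ H] [CompleteSpace H]

/-- The linear map sending a formal sum of pairs `(a, g)` to the sum of the vectors `π a (V g)`. -/
noncomputable def dilationMap (π : A →⋆ₐ[ℂ] (H →L[ℂ] H)) (V : G →L[ℂ] H) : (A →₀ G) →ₗ[ℂ] H :=
  Finsupp.lsum ℂ fun a => ((π a ∘L V : G →L[ℂ] H) : G →ₗ[ℂ] H)

omit [CompleteSpace G] in
@[simp]
lemma dilationMap_single (π : A →⋆ₐ[ℂ] (H →L[ℂ] H)) (V : G →L[ℂ] H) (a : A) (g : G) :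
    dilationMap π V (Finsupp.single a g) = π a (V g) := by
  simp [dilationMap]

/-- Apply an operator to the second entry of each formal pair. -/
noncomputable def mapVectors (A : Type*) (u : G →L[ℂ] G) : (A →₀ G) →ₗ[ℂ] (A →₀ G) :=
  Finsupp.mapRange.linearMap (u : G →ₗ[ℂ] G)

omit [Ring A] [StarRing A] [Algebra ℂ A] [CompleteSpace G] in
@[simp]
lemma mapVectors_single (u : G →L[ℂ] G) (a : A) (g : G) :
    mapVectors A u (Finsupp.single a g) = Finsupp.single a (u g) := by
  simp [mapVectors]

omit [CompleteSpace G] in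
/-- The range of `dilationMap` is invariant under the representation, compatibly with
`mapVectors`. -/
lemma exists_apply_dilationMap (π : A →⋆ₐ[ℂ] (H →L[ℂ] H)) (V : G →L[ℂ] H) (u : G →L[ℂ] G)
    (a : A) (m : A →₀ G) :
    ∃ m', dilationMap π V m' = π a (dilationMap π V m) ∧
      dilationMap π V (mapVectors A u m') = π a (dilationMap π V (mapVectors A u m)) := by
  induction m using Finsupp.induction_linear with
  | zero => exact ⟨0, by simp⟩
  | add m n hm hn =>
    obtain ⟨m', h₁, h₂⟩ := hm
    obtain ⟨n', h₃, h₄⟩ := hn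
    exact ⟨m' + n', by simp [h₁, h₃], by simp [h₂, h₄]⟩
  | single b g => exact ⟨Finsupp.single (a * b) g, by simp, by simp⟩

lemma inner_dilationMap_mapVectors (π : A →⋆ₐ[ℂ] (H →L[ℂ] H)) (V : G →L[ℂ] H) (u : G →L[ℂ] G)
    (hu : ∀ a, Commute (star u) (V.adjoint ∘L π a ∘L V)) (m n : A →₀ G) :
    inner ℂ (dilationMap π V (mapVectors A u m)) (dilationMap π V n) =
      inner ℂ (dilationMap π V m) (dilationMap π V (mapVectors A (star u) n)) := by
  have adj (a : A) (x y : H) : inner ℂ (π a x) y = inner ℂ x (π (star a) y) := by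
    rw [map_star, ContinuousLinearMap.star_eq_adjoint, ContinuousLinearMap.adjoint_inner_right]
  induction m using Finsupp.induction_linear with
  | zero => simp
  | add m m' hm hm' => simp only [map_add, inner_add_left, hm, hm']
  | single a g =>
    induction n using Finsupp.induction_linear with
    | zero => simp
    | add n n' hn hn' => simp only [map_add, inner_add_right, hn, hn']
    | single b h =>
      have key := congr($((hu (star a * b)).eq) h)
      simp only [mul_apply_eq_comp, ContinuousLinearMap.comp_apply, map_mul] at key
      simp only [mapVectors_single, dilationMap_single, adj]
      rw [← ContinuousLinearMap.adjoint_inner_right V (u g),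
        ← ContinuousLinearMap.adjoint_inner_right V g, ← key,
        ContinuousLinearMap.star_eq_adjoint u, ContinuousLinearMap.adjoint_inner_right u]

lemma eq_of_eqOn_topologicalClosure_orthogonal {F : Type*}
    [NormedAddCommGroup F] [NormedSpace ℂ F] {p : Submodule ℂ H} {S T : H →L[ℂ] F}
    (h₁ : ∀ x ∈ p, S x = T x) (h₂ : ∀ x ∈ p.topologicalClosureᗮ, S x = T x) : S = T := by
  have : CompleteSpace p.topologicalClosure :=
    p.isClosed_topologicalClosure.completeSpace_coe
  have h₃ (x : H) (hx : x ∈ p.topologicalClosure) : S x = T x :=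
    closure_minimal (t := {x | S x = T x}) h₁ (isClosed_eq S.continuous T.continuous) hx
  ext x
  obtain ⟨y, hy, z, hz, rfl⟩ := p.topologicalClosure.exists_add_mem_mem_orthogonal x
  simp [h₃ y hy, h₂ z hz]

/-- A unitary commuting with a compressed representation lifts to an operator commuting with the
representation. -/
lemma exists_intertwiner (π : A →⋆ₐ[ℂ] (H →L[ℂ] H)) (V : G →L[ℂ] H) (u : G →L[ℂ] G)
    (hunit : star u * u = 1)
    (hu : ∀ a, Commute (star u) (V.adjoint ∘L π a ∘L V)) :
    ∃ γ : H →L[ℂ] H, (∀ a, Commute (π a) γ) ∧ γ ∘L V = V ∘L u ∧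
      star γ ∘L V = V ∘L star u := by
  set Φ := dilationMap π V with hΦ
  set K := (LinearMap.range Φ).topologicalClosure with hK
  have hle : LinearMap.range Φ ≤ K := Submodule.le_topologicalClosure _
  have : CompleteSpace K := (Submodule.isClosed_topologicalClosure _).completeSpace_coe
  let e : (A →₀ G) →ₗ[ℂ] K := Φ.codRestrict K fun m => hle ⟨m, rfl⟩
  have he : DenseRange e := by
    intro x
    rw [closure_subtype, ← Set.range_comp]
    exact x.2
  have hnorm (m : A →₀ G) : ‖(Φ ∘ₗ mapVectors A u) m‖ ≤ 1 * ‖e m‖ := by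
    have h := inner_dilationMap_mapVectors π V u hu m (mapVectors A u m)
    have hm : mapVectors A (star u) (mapVectors A u m) = m := by
      ext a
      simpa [mapVectors] using congr($hunit (m a))
    rw [hm, inner_self_eq_norm_sq_to_K, inner_self_eq_norm_sq_to_K] at h
    have h' : ‖Φ (mapVectors A u m)‖ ^ 2 = ‖Φ m‖ ^ 2 := by exact_mod_cast h
    rw [one_mul]
    exact ((sq_eq_sq₀ (norm_nonneg _) (norm_nonneg _)).1 h').le
  let γ : H →L[ℂ] H := (Φ ∘ₗ mapVectors A u).extendOfNorm e ∘L K.orthogonalProjectionOnto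
  have hγ (m : A →₀ G) : γ (Φ m) = Φ (mapVectors A u m) := by
    have hp : K.orthogonalProjectionOnto (Φ m) = e m :=
      K.orthogonalProjectionOnto_mem_subspace_eq_self (e m)
    simp only [γ, ContinuousLinearMap.comp_apply, hp]
    exact LinearMap.extendOfNorm_eq he ⟨1, hnorm⟩ m
  have hγ₀ (x : H) (hx : x ∈ Kᗮ) : γ x = 0 := by
    simp [γ, K.orthogonalProjectionOnto_apply_of_mem_orthogonal hx]
  have hπ (a : A) (x : H) (hx : x ∈ Kᗮ) : π a x ∈ Kᗮ := by
    rw [hK, Submodule.orthogonal_closure] at hx ⊢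
    rw [Submodule.mem_orthogonal] at hx ⊢
    rintro _ ⟨m, rfl⟩
    obtain ⟨m', h, -⟩ := exists_apply_dilationMap π V u (star a) m
    rw [← ContinuousLinearMap.adjoint_inner_left, ← ContinuousLinearMap.star_eq_adjoint,
      ← map_star, ← h]
    exact hx _ ⟨m', rfl⟩
  have hV (g : G) : V g = Φ (Finsupp.single 1 g) := by simp [hΦ]
  refine ⟨γ, fun a => ?_, ?_, ?_⟩
  · refine eq_of_eqOn_topologicalClosure_orthogonal (p := LinearMap.range Φ)
      (fun x hx => ?_) fun x hx => ?_
    · obtain ⟨m, rfl⟩ := hx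
      obtain ⟨m', h, h'⟩ := exists_apply_dilationMap π V u a m
      simp only [mul_apply_eq_comp]
      rw [← h, hγ, hγ, h']
    · simp [hγ₀ x hx, hγ₀ _ (hπ a x hx)]
  · ext g
    simp only [ContinuousLinearMap.comp_apply]
    rw [hV, hγ, hV, mapVectors_single]
  · ext g
    simp only [ContinuousLinearMap.comp_apply]
    refine ext_inner_right ℂ fun x => ?_
    rw [ContinuousLinearMap.star_eq_adjoint γ, ContinuousLinearMap.adjoint_inner_left]
    refine congr($(eq_of_eqOn_topologicalClosure_orthogonal (p := LinearMap.range Φ)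
      (S := innerSL ℂ (V g) ∘L γ) (T := innerSL ℂ (V (star u g))) ?_ ?_) x)
    · rintro _ ⟨m, rfl⟩
      have h := inner_dilationMap_mapVectors π V u hu m (Finsupp.single 1 g)
      rw [mapVectors_single, ← hΦ, ← hV, ← hV, ← hγ] at h
      simpa using congr(starRingEnd ℂ $h)
    · intro y hy
      have hmem : V (star u g) ∈ K := hV (star u g) ▸ hle ⟨_, rfl⟩
      simp [hγ₀ y hy, Submodule.inner_right_of_mem_orthogonal hmem hy]

end Intertwiner

section Amplification

variable {I : Type*} [Fintype I] {G : Type*}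
  [NormedAddCommGroup G] [InnerProductSpace ℂ G] [CompleteSpace G]

/-- The operator acting as `a` in every summand of a finite direct sum. -/
noncomputable def diagonal (I : Type*) (a : G →L[ℂ] G) :
    PiLp 2 (fun _ : I => G) →L[ℂ] PiLp 2 (fun _ : I => G) :=
  ((PiLp.continuousLinearEquiv 2 ℂ fun _ : I => G).symm : (I → G) →L[ℂ] _) ∘L
    ContinuousLinearMap.piMap (fun _ => a) ∘L
      (PiLp.continuousLinearEquiv 2 ℂ fun _ : I => G : _ →L[ℂ] (I → G))

omit [Fintype I] [CompleteSpace G] in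
@[simp]
lemma diagonal_apply (a : G →L[ℂ] G) (x : PiLp 2 (fun _ : I => G)) (i : I) :
    diagonal I a x i = a (x i) := by
  simp [diagonal]

variable (I G) in
/-- The diagonal representation of `B(G)` on a finite direct sum of copies of `G`. -/
noncomputable def amplification :
    (G →L[ℂ] G) →⋆ₐ[ℂ] (PiLp 2 (fun _ : I => G) →L[ℂ] PiLp 2 (fun _ : I => G)) where
  toFun := diagonal I
  map_one' := by ext; simp
  map_mul' a b := by ext; simp
  map_zero' := by ext; simp
  map_add' a b := by ext; simp
  commutes' r := by ext; simp [Algebra.algebraMap_eq_smul_one]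
  map_star' a := by
    rw [ContinuousLinearMap.star_eq_adjoint (diagonal I a), ContinuousLinearMap.eq_adjoint_iff]
    intro x y
    simp [PiLp.inner_apply, ContinuousLinearMap.star_eq_adjoint,
      ContinuousLinearMap.adjoint_inner_left]

@[simp]
lemma amplification_apply (a : G →L[ℂ] G) (x : PiLp 2 (fun _ : I => G)) (i : I) :
    amplification I G a x i = a (x i) :=
  diagonal_apply a x i

/-- The column operator of a finite family. -/
noncomputable def column (L : I → (G →L[ℂ] G)) : G →L[ℂ] PiLp 2 (fun _ : I => G) :=
  ((PiLp.continuousLinearEquiv 2 ℂ fun _ : I => G).symm : (I → G) →L[ℂ] _) ∘L ContinuousLinearMap.pi L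

omit [Fintype I] [CompleteSpace G] in
@[simp]
lemma column_apply (L : I → (G →L[ℂ] G)) (g : G) (i : I) : column L g i = L i g := by
  simp [column]

lemma adjoint_column_comp_amplification_comp_column (L : I → (G →L[ℂ] G)) (a : G →L[ℂ] G) :
    (column L).adjoint ∘L amplification I G a ∘L column L = ∑ i, star (L i) * a * L i := by
  ext g
  refine ext_inner_left ℂ fun h => ?_
  simp [ContinuousLinearMap.adjoint_inner_right, PiLp.inner_apply, inner_sum,
    ContinuousLinearMap.star_eq_adjoint]

/-- The inclusion of a summand. -/
noncomputable def inclusion [DecidableEq I] (i : I) : G →L[ℂ] PiLp 2 (fun _ : I => G) :=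
  column fun j => if j = i then 1 else 0

/-- The matrix entries of an operator on a finite direct sum. -/
noncomputable def entry [DecidableEq I]
    (γ : PiLp 2 (fun _ : I => G) →L[ℂ] PiLp 2 (fun _ : I => G)) (i j : I) : G →L[ℂ] G :=
  PiLp.proj 2 (fun _ : I => G) i ∘L γ ∘L inclusion j

variable [DecidableEq I]

omit [Fintype I] [CompleteSpace G] in
lemma entry_apply (γ : PiLp 2 (fun _ : I => G) →L[ℂ] PiLp 2 (fun _ : I => G)) (i j : I) (g : G) :
    entry γ i j g = γ (inclusion j g) i := rfl

omit [CompleteSpace G] in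
lemma inner_inclusion_left (i : I) (g : G) (x : PiLp 2 (fun _ : I => G)) :
    inner ℂ (inclusion i g) x = inner ℂ g (x i) := by
  rw [PiLp.inner_apply, Finset.sum_eq_single i] <;> simp +contextual [inclusion]

lemma entry_star (γ : PiLp 2 (fun _ : I => G) →L[ℂ] PiLp 2 (fun _ : I => G)) (i j : I) :
    entry (star γ) i j = star (entry γ j i) := by
  rw [ContinuousLinearMap.star_eq_adjoint (entry γ j i), ContinuousLinearMap.eq_adjoint_iff]
  intro x y
  rw [entry_apply, entry_apply, ← inner_inclusion_left, ← inner_conj_symm,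
    ← inner_inclusion_left, inner_conj_symm, ContinuousLinearMap.star_eq_adjoint,
    ContinuousLinearMap.adjoint_inner_left]

omit [CompleteSpace G] in
lemma sum_entry_comp (γ : PiLp 2 (fun _ : I => G) →L[ℂ] PiLp 2 (fun _ : I => G))
    (L : I → (G →L[ℂ] G)) (i : I) (g : G) :
    ∑ j, entry γ i j (L j g) = γ (column L g) i := by
  have h : column L g = ∑ j, inclusion j (L j g) := by
    ext i
    simp only [inclusion, WithLp.ofLp_sum, Finset.sum_apply, column_apply]
    rw [Finset.sum_eq_single i] <;> simp +contextual [eq_comm]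
  simp [h, entry_apply]

lemma commute_entry {γ : PiLp 2 (fun _ : I => G) →L[ℂ] PiLp 2 (fun _ : I => G)} {a : G →L[ℂ] G}
    (h : Commute (amplification I G a) γ) (i j : I) : Commute a (entry γ i j) := by
  ext g
  have h' : amplification I G a (inclusion j g) = inclusion j (a g) := by
    ext k
    by_cases hk : k = j <;> simp [inclusion, hk]
  have := congr($h.eq (inclusion j g) i)
  simpa [entry_apply, h'] using this

end Amplification

/-- The matrix coefficients exist for every element of a closed star subalgebra commuting with the
image of the Kraus map. -/
lemma exists_intertwiner_of_commute {I G : Type*} [Fintype I] [NormedAddCommGroup G]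
    [InnerProductSpace ℂ G] [CompleteSpace G] (S : StarSubalgebra ℂ (G →L[ℂ] G))
    [IsClosed (S : Set (G →L[ℂ] G))] (L : I → (G →L[ℂ] G))
    (hS : ∀ a ∈ S, ∀ c ∈ S, Commute c (∑ i, star (L i) * a * L i)) (c : S) :
    ∃ γ : PiLp 2 (fun _ : I => G) →L[ℂ] PiLp 2 (fun _ : I => G),
      (∀ a : S, Commute (amplification I G a) γ) ∧ γ ∘L column L = column L ∘L c ∧
      star γ ∘L column L = column L ∘L star (c : G →L[ℂ] G) := by
  have hc : c ∈ Submodule.span ℂ (unitary S : Set S) := by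
    rw [CStarAlgebra.span_unitary]
    trivial
  induction hc using Submodule.span_induction with
  | mem u hu =>
    refine exists_intertwiner ((amplification I G).comp S.subtype) (column L) u ?_ fun a => ?_
    · exact congr(($((Unitary.mem_iff.1 hu).1) : G →L[ℂ] G))
    · have := hS a a.2 _ (star_mem u.2)
      rwa [← adjoint_column_comp_amplification_comp_column] at this
  | zero => exact ⟨0, by simp, by simp, by simp [ContinuousLinearMap.star_eq_adjoint]⟩
  | add x y _ _ hx hy =>
    obtain ⟨γ, h₁, h₂, h₃⟩ := hx
    obtain ⟨δ, h₄, h₅, h₆⟩ := hy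
    exact ⟨γ + δ, fun a => (h₁ a).add_right (h₄ a), by simp [h₂, h₅],
      by simp_all [ContinuousLinearMap.star_eq_adjoint]⟩
  | smul r x _ hx =>
    obtain ⟨γ, h₁, h₂, h₃⟩ := hx
    exact ⟨r • γ, fun a => (h₁ a).smul_right r, by simp [h₂], by simp [h₃]⟩

end KrausMasa

/-- (Necessity in Corollary 3.4.) Let `C` be a maximal abelian von Neumann subalgebra of
`B(G)` (i.e. `C` equals its own commutant) and `T(b) = ∑ i, star (L i) * b * L i` a Kraus-form
CP map. If `T` leaves `C` globally invariant, then there exist coefficient functions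
`cc` with values in `C` such that `cc (star c) i j = star (cc c j i)` and
`c * L i - L i * c = ∑ j, cc c i j * L j` for all `c ∈ C`. -/
theorem exists_coefficients_of_kraus_map_leaves_masa_invariant
    {G : Type*} [NormedAddCommGroup G] [InnerProductSpace ℂ G] [CompleteSpace G]
    (C : VonNeumannAlgebra G) (hmasa : C.commutant = C)
    {I : Type*} [Fintype I] (L : I → (G →L[ℂ] G))
    (hT : ∀ c ∈ C, (∑ i, star (L i) * c * L i) ∈ C) :
    ∃ cc : (G →L[ℂ] G) → I → I → (G →L[ℂ] G),
      (∀ c ∈ C, ∀ i j, cc c i j ∈ C) ∧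
      (∀ c ∈ C, ∀ i j, cc (star c) i j = star (cc c j i)) ∧
      (∀ c ∈ C, ∀ i, c * L i - L i * c = ∑ j, cc c i j * L j) := by
  classical
  have mem_iff (z : G →L[ℂ] G) : z ∈ C ↔ ∀ c ∈ C, c * z = z * c := by
    rw [← VonNeumannAlgebra.mem_commutant_iff, hmasa]
  have hclosed : IsClosed (C.toStarSubalgebra : Set (G →L[ℂ] G)) := by
    rw [VonNeumannAlgebra.coe_toStarSubalgebra, ← C.centralizer_centralizer]
    exact Set.isClosed_centralizer _
  have hex (c : G →L[ℂ] G) := fun hc : c ∈ C =>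
    KrausMasa.exists_intertwiner_of_commute C.toStarSubalgebra L
      (fun a ha d hd => (mem_iff _).1 (hT a ha) d hd) ⟨c, hc⟩
  choose! γ₀ hcomm hV hVstar using hex
  let γ c := (2⁻¹ : ℂ) • (γ₀ c + star (γ₀ (star c)))
  have hγstar c : γ (star c) = star (γ c) := by
    simp only [γ]
    rw [add_comm]
    simp [ContinuousLinearMap.star_eq_adjoint, map_smulₛₗ, Complex.conj_ofNat]
  have hγV (c : G →L[ℂ] G) (hc : c ∈ C) :
      γ c ∘L KrausMasa.column L = KrausMasa.column L ∘L c := by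
    have h := hVstar (star c) (star_mem hc)
    simp only [star_star] at h
    simp only [γ, ContinuousLinearMap.smul_comp, ContinuousLinearMap.add_comp, hV c hc, h]
    rw [← two_smul ℂ, smul_smul]
    norm_num
  have hγcomm (c : G →L[ℂ] G) (hc : c ∈ C) (a : G →L[ℂ] G) (ha : a ∈ C) :
      Commute (KrausMasa.amplification I G a) (γ c) := by
    refine ((hcomm c hc ⟨a, ha⟩).add_right ?_).smul_right _
    have h := (hcomm (star c) (star_mem hc) ⟨star a, star_mem ha⟩).star_star
    simpa only [map_star, star_star] using h
  refine ⟨fun c i j => (if i = j then c else 0) - KrausMasa.entry (γ c) i j, ?_, ?_, ?_⟩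
  · intro c hc i j
    refine sub_mem (by split_ifs <;> simp [hc, zero_mem]) ((mem_iff _).2 fun a ha => ?_)
    exact KrausMasa.commute_entry (hγcomm c hc a ha) i j
  · intro c _ i j
    beta_reduce
    rw [hγstar, KrausMasa.entry_star, star_sub]
    congr 1
    by_cases h : i = j <;> simp [h, eq_comm]
  · intro c hc i
    ext g
    have h := congr(($(hγV c hc) g) i)
    simp only [ContinuousLinearMap.comp_apply, KrausMasa.column_apply] at h
    rw [← KrausMasa.sum_entry_comp] at h
    simp [sub_mul, Finset.sum_sub_distrib, ite_mul, ← h]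
end

section
/- Let G be a complex Hilbert space, let C be a maximal abelian von Neumann subalgebra of B(G) (i.e. C equals its own commutant), let I be a finite index set, let (K_i)_{i∈I} be a family in B(G), let γ ∈ C be self-adjoint, and let 𝓛 : B(G) → B(G) be a linear map satisfying 𝓛(c) = Σ_{i∈I} K_i* c K_i + γ c for all c ∈ C. Suppose for every c ∈ C there exist elements c_{ij}(c) ∈ C (i, j ∈ I) satisfying c_{ij}(c*) = c_{ji}(c)* and c K_i − K_i c = Σ_{j∈I} c_{ij}(c) K_j for all i ∈ I. Then 𝓛(c) ∈ C for every c ∈ C, i.e. 𝓛 leaves C globally invariant. -/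
/-- Elements of a von Neumann algebra equal to its commutant commute. -/
theorem VonNeumannAlgebra.mul_comm_of_commutant_eq
    {G : Type*} [NormedAddCommGroup G] [InnerProductSpace ℂ G] [CompleteSpace G]
    {C : VonNeumannAlgebra G} (hC : C.commutant = C) {a b : G →L[ℂ] G}
    (ha : a ∈ C) (hb : b ∈ C) : a * b = b * a :=
  VonNeumannAlgebra.mem_commutant_iff.1 (hC.symm ▸ hb) a ha

/-- If the commutators of `c` and `star c` with a finite family `K` are given by coefficient
matrices that are adjoint to each other and commute with `a`, then `c` commutes with
`∑ i, star (K i) * a * K i`. -/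
theorem mul_sum_star_mul_mul_comm {R I : Type*} [Ring R] [StarRing R] [Fintype I]
    (K : I → R) {a c : R} (m n : I → I → R)
    (hac : c * a = a * c) (ham : ∀ i j, m i j * a = a * m i j)
    (hmn : ∀ i j, n i j = star (m j i))
    (hm : ∀ i, c * K i - K i * c = ∑ j, m i j * K j)
    (hn : ∀ i, star c * K i - K i * star c = ∑ j, n i j * K j) :
    c * (∑ i, star (K i) * a * K i) = (∑ i, star (K i) * a * K i) * c := by
  have hright (i : I) : K i * c = c * K i - ∑ j, m i j * K j := by
    rw [← hm i]; abel
  have hleft (i : I) : c * star (K i) = star (K i) * c - ∑ j, star (K j) * m j i := by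
    have h := congrArg star (hn i)
    simp only [star_sub, star_mul, star_star, star_sum, hmn] at h
    rw [← h]; abel
  have hL : c * (∑ i, star (K i) * a * K i) =
      (∑ i, star (K i) * (a * c) * K i) - ∑ i, ∑ j, star (K j) * (a * m j i) * K i := by
    rw [Finset.mul_sum, ← Finset.sum_sub_distrib]
    refine Finset.sum_congr rfl fun i _ => ?_
    rw [← mul_assoc, ← mul_assoc, hleft]
    simp only [sub_mul, Finset.sum_mul, mul_assoc, ← hac, ← ham]
  have hR : (∑ i, star (K i) * a * K i) * c =
      (∑ i, star (K i) * (a * c) * K i) - ∑ i, ∑ j, star (K i) * (a * m i j) * K j := by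
    rw [Finset.sum_mul, ← Finset.sum_sub_distrib]
    refine Finset.sum_congr rfl fun i _ => ?_
    rw [mul_assoc, hright]
    simp only [mul_sub, Finset.mul_sum, mul_assoc]
  rw [hL, hR, Finset.sum_comm]

/-- (Sufficiency, B(G)-coordinate form, for generators.) Let `C` be a maximal abelian von
Neumann subalgebra of `B(G)` (i.e. `C` equals its own commutant), `(K i)` a finite family of
operators, `γ ∈ C` self-adjoint, and `𝓛` a linear map with
`𝓛 c = ∑ i, star (K i) * c * K i + γ * c` for `c ∈ C`. If for every `c ∈ C` there are
coefficients `cc c i j ∈ C` with `cc (star c) i j = star (cc c j i)` and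
`c * K i - K i * c = ∑ j, cc c i j * K j`, then `𝓛` leaves `C` globally invariant. -/
theorem generator_leaves_masa_invariant_of_coefficients
    {G : Type*} [NormedAddCommGroup G] [InnerProductSpace ℂ G] [CompleteSpace G]
    (C : VonNeumannAlgebra G) (hmasa : C.commutant = C)
    {I : Type*} [Fintype I] (K : I → (G →L[ℂ] G))
    (γ : G →L[ℂ] G) (hγ : γ ∈ C) (hγ_sa : star γ = γ)
    (𝓛 : (G →L[ℂ] G) →ₗ[ℂ] (G →L[ℂ] G))
    (h𝓛 : ∀ c ∈ C, 𝓛 c = (∑ i, star (K i) * c * K i) + γ * c)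
    (cc : (G →L[ℂ] G) → I → I → (G →L[ℂ] G))
    (hmem : ∀ c ∈ C, ∀ i j, cc c i j ∈ C)
    (hstar : ∀ c ∈ C, ∀ i j, cc (star c) i j = star (cc c j i))
    (hrel : ∀ c ∈ C, ∀ i, c * K i - K i * c = ∑ j, cc c i j * K j) :
    ∀ c ∈ C, 𝓛 c ∈ C := by
  intro a ha
  rw [h𝓛 a ha]
  refine add_mem ?_ (mul_mem hγ ha)
  rw [← hmasa, VonNeumannAlgebra.mem_commutant_iff]
  intro c hc
  exact mul_sum_star_mul_mul_comm K (cc c) (cc (star c))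
    (VonNeumannAlgebra.mul_comm_of_commutant_eq hmasa hc ha)
    (fun i j => VonNeumannAlgebra.mul_comm_of_commutant_eq hmasa (hmem c hc i j) ha)
    (hstar c hc) (hrel c hc) (hrel (star c) (star_mem hc))
end
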